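/- arXiv:2501.01006 — 2 statements merged into one kernel-verified Lean document; each statement's English description precedes it below -/
import Mathlib

section
/- Let w₀ and w₁ be nonzero complex numbers, let ℓ₀ and ℓ₁ be the preferred logarithms of w₀ and w₁ respectively, and let ℓ₂ be the preferred logarithm of (w₀·w₁)⁻¹. Then: (1) if both w₀ and w₁ are positive real numbers, then ℓ₀ + ℓ₁ + ℓ₂ = 0; (2) if Im(ℓ₀) + Im(ℓ₁) ≤ 2π and not both w₀, w₁ are positive reals, then ℓ₀ + ℓ₁ + ℓ₂ = 2πi; (3) if Im(ℓ₀) + Im(ℓ₁) > 2π, then ℓ₀ + ℓ₁ + ℓ₂ = 4πi. -/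
theorem Complex.exp_pos_real_iff_im_eq_zero {z : ℂ} (hz : 0 ≤ z.im ∧ z.im < 2 * Real.pi) :
    ((Complex.exp z).im = 0 ∧ 0 < (Complex.exp z).re) ↔ z.im = 0 := by
  rw [Complex.exp_im, Complex.exp_re]
  constructor
  · rintro ⟨hs, hc⟩
    have hs' : Real.sin z.im = 0 := (mul_eq_zero.mp hs).resolve_left (Real.exp_ne_zero _)
    have hc' : 0 < Real.cos z.im := pos_of_mul_pos_right hc (Real.exp_pos _).le
    have h1 : Real.cos z.im = 1 := by nlinarith [Real.sin_sq_add_cos_sq z.im]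
    exact (Real.cos_eq_one_iff_of_lt_of_lt (by linarith [Real.pi_pos]) hz.2).mp h1
  · intro h
    simp [h, Real.exp_pos]

/-- For nonzero `w₀, w₁` with preferred logarithms `ℓ₀, ℓ₁`, and `ℓ₂`
the preferred logarithm of `(w₀·w₁)⁻¹`: (1) if both `w₀, w₁` are positive reals then
`ℓ₀ + ℓ₁ + ℓ₂ = 0`; (2) if `Im ℓ₀ + Im ℓ₁ ≤ 2π` and not both are positive reals then
`ℓ₀ + ℓ₁ + ℓ₂ = 2πi`; (3) if `Im ℓ₀ + Im ℓ₁ > 2π` then `ℓ₀ + ℓ₁ + ℓ₂ = 4πi`. -/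
theorem stmt2 (w₀ w₁ : ℂ) (h₀ : w₀ ≠ 0) (h₁ : w₁ ≠ 0) (ℓ₀ ℓ₁ ℓ₂ : ℂ)
    (he₀ : Complex.exp ℓ₀ = w₀) (hi₀ : 0 ≤ ℓ₀.im ∧ ℓ₀.im < 2 * Real.pi)
    (he₁ : Complex.exp ℓ₁ = w₁) (hi₁ : 0 ≤ ℓ₁.im ∧ ℓ₁.im < 2 * Real.pi)
    (he₂ : Complex.exp ℓ₂ = (w₀ * w₁)⁻¹) (hi₂ : 0 ≤ ℓ₂.im ∧ ℓ₂.im < 2 * Real.pi) :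
    (((w₀.im = 0 ∧ 0 < w₀.re) ∧ (w₁.im = 0 ∧ 0 < w₁.re)) → ℓ₀ + ℓ₁ + ℓ₂ = 0) ∧
    ((ℓ₀.im + ℓ₁.im ≤ 2 * Real.pi ∧ ¬((w₀.im = 0 ∧ 0 < w₀.re) ∧ (w₁.im = 0 ∧ 0 < w₁.re))) →
      ℓ₀ + ℓ₁ + ℓ₂ = 2 * Real.pi * Complex.I) ∧
    (2 * Real.pi < ℓ₀.im + ℓ₁.im → ℓ₀ + ℓ₁ + ℓ₂ = 4 * Real.pi * Complex.I) := by
  subst he₀ he₁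
  rw [Complex.exp_pos_real_iff_im_eq_zero hi₀, Complex.exp_pos_real_iff_im_eq_zero hi₁]
  have hexp : Complex.exp (ℓ₀ + ℓ₁ + ℓ₂) = 1 := by
    rw [Complex.exp_add, Complex.exp_add, he₂, mul_inv_cancel₀ (mul_ne_zero h₀ h₁)]
  obtain ⟨n, hn⟩ := Complex.exp_eq_one_iff.mp hexp
  have him : ℓ₀.im + ℓ₁.im + ℓ₂.im = n * (2 * Real.pi) := by
    simpa using congrArg Complex.im hn
  obtain ⟨hi₀, hi₀'⟩ := hi₀
  obtain ⟨hi₁, hi₁'⟩ := hi₁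
  obtain ⟨hi₂, hi₂'⟩ := hi₂
  have hpi : 0 < 2 * Real.pi := Real.two_pi_pos
  have lower {k : ℤ} (h : k * (2 * Real.pi) < ℓ₀.im + ℓ₁.im + ℓ₂.im) : k < n := by
    rw [him] at h
    exact_mod_cast lt_of_mul_lt_mul_right h hpi.le
  have upper {k : ℤ} (h : ℓ₀.im + ℓ₁.im + ℓ₂.im < k * (2 * Real.pi)) : n < k := by
    rw [him] at h
    exact_mod_cast lt_of_mul_lt_mul_right h hpi.le
  rw [hn]
  refine ⟨fun ⟨h, h'⟩ => ?_, fun ⟨h, h'⟩ => ?_, fun h => ?_⟩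
  · have hl : -1 < n := lower (by push_cast; linarith)
    have hu : n < 1 := upper (by push_cast; linarith)
    obtain rfl : n = 0 := by omega
    simp
  · have hpos : 0 < ℓ₀.im + ℓ₁.im := by
      by_contra! hle
      exact h' ⟨by linarith, by linarith⟩
    have hl : 0 < n := lower (by push_cast; linarith)
    have hu : n < 2 := upper (by push_cast; linarith)
    obtain rfl : n = 1 := by omega
    simp
  · have hl : 1 < n := lower (by push_cast; linarith)
    have hu : n < 3 := upper (by push_cast; linarith)
    obtain rfl : n = 2 := by omega
    push_cast
    ring
end

section
/- Let L : ℂ → ℂ be any function such that for every nonzero complex number z one has exp(L z) = z and the imaginary part of L z lies in [0, 2π). Let T = [[1, 0], [0, −1]] and S = [[−1/2, 1], [3/4, 1/2]] be 2 × 2 complex matrices. Then the sum of L λ over the multiset of roots λ of the characteristic polynomial of T, plus the sum of L λ over the multiset of roots of the characteristic polynomial of S, plus the sum of L λ over the multiset of roots of the characteristic polynomial of (T·S)⁻¹, equals 4πi. -/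
open Polynomial in
theorem Matrix.charpoly_roots_fin_two {R : Type*} [CommRing R] [IsDomain R]
    (M : Matrix (Fin 2) (Fin 2) R) (a b : R) (htr : M.trace = a + b) (hdet : M.det = a * b) :
    M.charpoly.roots = {a, b} := by
  have h : M.charpoly = (({a, b} : Multiset R).map fun x => X - C x).prod := by
    rw [Matrix.charpoly_fin_two, htr, hdet]
    simp only [Multiset.insert_eq_cons, Multiset.map_cons, Multiset.map_singleton,
      Multiset.prod_cons, Multiset.prod_singleton, C_add, C_mul]
    ring
  rw [h, roots_multiset_prod_X_sub_C]

/-- The complex exponential is injective on the strip `0 ≤ im z < 2π`. -/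
theorem Complex.exp_injOn_im_Ico :
    Set.InjOn Complex.exp {z : ℂ | 0 ≤ z.im ∧ z.im < 2 * Real.pi} := by
  rintro z ⟨hz₀, hz₁⟩ w ⟨hw₀, hw₁⟩ h
  obtain ⟨n, hn⟩ := Complex.exp_eq_exp_iff_exists_int.mp h
  have him : z.im = w.im + n * (2 * Real.pi) := by simp [hn]
  have hlt : (n : ℝ) < 1 := by nlinarith [Real.pi_pos]
  have hgt : (-1 : ℝ) < n := by nlinarith [Real.pi_pos]
  have hn₀ : n = 0 := by
    have h₁ : n < 1 := by exact_mod_cast hlt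
    have h₂ : -1 < n := by exact_mod_cast hgt
    omega
  simpa [hn₀] using hn

/-- For a preferred-logarithm function `L` and
`T = [[1,0],[0,-1]]`, `S = [[-1/2,1],[3/4,1/2]]`, the sum of `L λ` over the multisets
of roots of the characteristic polynomials of `T`, `S`, and `(T·S)⁻¹` equals `4πi`. -/
theorem stmt10 (L : ℂ → ℂ)
    (hL : ∀ z : ℂ, z ≠ 0 → Complex.exp (L z) = z ∧ 0 ≤ (L z).im ∧ (L z).im < 2 * Real.pi)
    (T S : Matrix (Fin 2) (Fin 2) ℂ)
    (hT : T = !![1, 0; 0, -1]) (hS : S = !![-(1/2 : ℂ), 1; 3/4, 1/2]) :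
    ((T.charpoly.roots).map L).sum + ((S.charpoly.roots).map L).sum +
      ((((T * S)⁻¹).charpoly.roots).map L).sum = 4 * Real.pi * Complex.I := by
  have hlog (t : ℝ) (h₀ : 0 ≤ t) (h₁ : t < 2 * Real.pi) :
      L (Complex.exp (t * Complex.I)) = t * Complex.I := by
    obtain ⟨hexp, him⟩ := hL _ (Complex.exp_ne_zero (t * Complex.I))
    exact Complex.exp_injOn_im_Ico him (by simpa using ⟨h₀, h₁⟩) hexp
  have hpi := Real.pi_pos
  have hL_one : L 1 = 0 := by simpa using hlog 0 le_rfl (by positivity)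
  have hL_neg_one : L (-1) = Real.pi * Complex.I := by
    simpa [Complex.exp_pi_mul_I] using hlog Real.pi hpi.le (by linarith)
  obtain ⟨ζ, hζ⟩ : ∃ ζ, ζ = Complex.exp ((2 * Real.pi / 3 : ℝ) * Complex.I) := ⟨_, rfl⟩
  have hprim : IsPrimitiveRoot ζ 3 := by
    convert Complex.isPrimitiveRoot_exp 3 (by norm_num) using 1
    rw [hζ]
    congr 1
    push_cast
    ring
  have hsum : 1 + ζ + ζ ^ 2 = 0 := by
    simpa [Finset.sum_range_succ] using hprim.geom_sum_eq_zero (by norm_num)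
  have hζ_sq : ζ ^ 2 = Complex.exp ((4 * Real.pi / 3 : ℝ) * Complex.I) := by
    rw [hζ, ← Complex.exp_nat_mul]
    congr 1
    push_cast
    ring
  have hL_ζ : L ζ = (2 * Real.pi / 3 : ℝ) * Complex.I := by
    rw [hζ, hlog _ (by positivity) (by linarith)]
  have hL_ζ_sq : L (ζ ^ 2) = (4 * Real.pi / 3 : ℝ) * Complex.I := by
    rw [hζ_sq, hlog _ (by positivity) (by linarith)]
  have hTS : (T * S)⁻¹ = !![-(1/2 : ℂ), -1; 3/4, -(1/2)] := by
    apply Matrix.inv_eq_right_inv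
    rw [hT, hS]
    ext i j
    fin_cases i <;> fin_cases j <;> norm_num [Matrix.mul_apply, Fin.sum_univ_two]
  rw [hTS, Matrix.charpoly_roots_fin_two T 1 (-1) (by simp [hT, Matrix.trace_fin_two])
      (by simp [hT]),
    Matrix.charpoly_roots_fin_two S 1 (-1) (by simp [hS, Matrix.trace_fin_two])
      (by norm_num [hS, Matrix.det_fin_two]),
    Matrix.charpoly_roots_fin_two _ ζ (ζ ^ 2)
      (by simp only [Matrix.trace_fin_two_of]; linear_combination -hsum)
      (by simp only [Matrix.det_fin_two_of]; linear_combination -hprim.pow_eq_one)]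
  simp only [Multiset.insert_eq_cons, Multiset.map_cons, Multiset.map_singleton,
    Multiset.sum_cons, Multiset.sum_singleton, hL_one, hL_neg_one, hL_ζ, hL_ζ_sq]
  push_cast
  ring
end
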